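/- (Sufficiency: the integral equation characterizes equilibrium strategies) Suppose a function V is twice continuously differentiable on a neighborhood N of a point k∞, satisfies the integral equation (IE): V(k₀) = ∫₀^∞ h(t)·u(φ(V′(K_t),K_t),K_t) dt + ∫₀^∞ H(t)·U(φ(V′(K_t),K_t),K_t) dt for all k₀ ∈ N, where K_t = K(t;k₀,σ) and σ(k) := φ(V′(k),k), and suppose the strategy σ is convergent (to k∞ on N). Then σ is an equilibrium strategy. -/

import Mathlib

open MeasureTheory Filter Set

noncomputable def pd1 (u : ℝ → ℝ → ℝ) (c k : ℝ) : ℝ := deriv (fun x => u x k) c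
noncomputable def pd2 (u : ℝ → ℝ → ℝ) (c k : ℝ) : ℝ := deriv (fun y => u c y) k
noncomputable def pd11 (u : ℝ → ℝ → ℝ) (c k : ℝ) : ℝ := deriv (fun x => pd1 u x k) c

noncomputable def Pval (u U : ℝ → ℝ → ℝ) (h H : ℝ → ℝ) (σ : ℝ → ℝ)
    (K R : ℝ → ℝ → ℝ) (k₀ c : ℝ) : ℝ :=
  u c k₀ - u (σ k₀) k₀ + (U c k₀ - U (σ k₀) k₀) +
  ∫ t in Set.Ioi (0:ℝ),
    (h t * (pd1 u (σ (K t k₀)) (K t k₀) * deriv σ (K t k₀) + pd2 u (σ (K t k₀)) (K t k₀)) +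
     H t * (pd1 U (σ (K t k₀)) (K t k₀) * deriv σ (K t k₀) + pd2 U (σ (K t k₀)) (K t k₀)))
    * (R k₀ t * (σ k₀ - c))

theorem exists_abs_le_of_continuousOn_of_tendsto {y : ℝ → ℝ} {L : ℝ}
    (hy : ContinuousOn y (Ici 0)) (hL : Tendsto y atTop (nhds L)) :
    ∃ C, ∀ t, 0 ≤ t → |y t| ≤ C := by
  obtain ⟨T, hT⟩ := eventually_atTop.1 (hL.abs.eventually_le_const (lt_add_one |L|))
  obtain ⟨B, hB⟩ := isCompact_Icc.exists_bound_of_continuousOn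
    (hy.mono (Icc_subset_Ici_self : Icc 0 T ⊆ Ici 0))
  refine ⟨max B (|L| + 1), fun t ht => ?_⟩
  rcases le_total t T with h | h
  · exact le_max_of_le_left (hB t ⟨ht, h⟩)
  · exact le_max_of_le_right (hT t h)

/-- Solutions of a scalar linear equation on the half-line. -/
theorem eq_mul_exp_integral {a z : ℝ → ℝ} (ha : ContinuousOn a (Ici 0))
    (hz : ∀ t, 0 ≤ t → HasDerivAt z (a t * z t) t) {t : ℝ} (ht : 0 ≤ t) :
    z t = z 0 * Real.exp (∫ r in (0:ℝ)..t, a r) := by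
  have hb : Continuous fun r => a (max r 0) :=
    ha.comp_continuous (by fun_prop) fun r => le_max_right r 0
  have hA : ∀ s, HasDerivAt (fun s => ∫ r in (0:ℝ)..s, a (max r 0)) (a (max s 0)) s := fun s =>
    hb.integral_hasStrictDerivAt 0 s |>.hasDerivAt
  have hd : ∀ s, 0 ≤ s →
      HasDerivAt (fun s => z s * Real.exp (-∫ r in (0:ℝ)..s, a (max r 0))) 0 s := by
    intro s hs
    refine ((hz s hs).mul (hA s).neg.exp).congr_deriv ?_
    rw [max_eq_left hs]
    ring
  have hconst := constant_of_has_deriv_right_zero (a := 0) (b := t)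
    (fun s hs => (hd s hs.1).continuousAt.continuousWithinAt)
    (fun s hs => (hd s hs.1).hasDerivWithinAt) t ⟨ht, le_rfl⟩
  have hint : ∫ r in (0:ℝ)..t, a r = ∫ r in (0:ℝ)..t, a (max r 0) := by
    refine intervalIntegral.integral_congr fun r hr => ?_
    rw [uIcc_of_le ht] at hr
    simp only [max_eq_left hr.1]
  simp only [intervalIntegral.integral_same, neg_zero, Real.exp_zero, mul_one] at hconst
  rw [hint, ← hconst, mul_assoc, ← Real.exp_add, neg_add_cancel, Real.exp_zero, mul_one]

theorem ode_unique_of_contDiffOn {g x y : ℝ → ℝ} {N : Set ℝ} (hN : IsOpen N)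
    (hg : ContDiffOn ℝ 1 g N)
    (hx : ∀ t, 0 ≤ t → HasDerivAt x (g (x t)) t) (hxN : ∀ t, 0 ≤ t → x t ∈ N)
    (hy : ∀ t, 0 ≤ t → HasDerivAt y (g (y t)) t) (hyN : ∀ t, 0 ≤ t → y t ∈ N)
    (h0 : x 0 = y 0) {t : ℝ} (ht : 0 ≤ t) : x t = y t := by
  have hxc : ContinuousOn x (Icc 0 t) := fun s hs => (hx s hs.1).continuousAt.continuousWithinAt
  have hyc : ContinuousOn y (Icc 0 t) := fun s hs => (hy s hs.1).continuousAt.continuousWithinAt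
  have hS : IsCompact (x '' Icc 0 t ∪ y '' Icc 0 t) :=
    (isCompact_Icc.image_of_continuousOn hxc).union (isCompact_Icc.image_of_continuousOn hyc)
  have hSN : x '' Icc 0 t ∪ y '' Icc 0 t ⊆ N := by
    rintro _ (⟨s, hs, rfl⟩ | ⟨s, hs, rfl⟩)
    exacts [hxN s hs.1, hyN s hs.1]
  obtain ⟨C, hC⟩ := LocallyLipschitzOn.exists_lipschitzOnWith_of_compact hS (f := g) (by
    intro z hz
    obtain ⟨C, s, hs, hC⟩ :=
      (hg.contDiffAt (hN.mem_nhds (hSN hz))).exists_lipschitzOnWith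
    exact ⟨C, s, mem_nhdsWithin_of_mem_nhds hs, hC⟩)
  exact ODE_solution_unique_of_mem_Icc_right (v := fun _ => g)
    (s := fun _ => x '' Icc 0 t ∪ y '' Icc 0 t) (fun _ _ => hC)
    hxc (fun s hs => (hx s hs.1).hasDerivWithinAt)
    (fun s hs => Or.inl ⟨s, ⟨hs.1, hs.2.le⟩, rfl⟩)
    hyc (fun s hs => (hy s hs.1).hasDerivWithinAt)
    (fun s hs => Or.inr ⟨s, ⟨hs.1, hs.2.le⟩, rfl⟩) h0 ⟨ht, le_rfl⟩

/-- A convergent solution of an autonomous equation converges to a rest point. -/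
theorem eq_zero_of_tendsto_of_ode {g x : ℝ → ℝ} {k : ℝ} (hg : ContinuousAt g k)
    (hx : ∀ t, 0 ≤ t → HasDerivAt x (g (x t)) t) (hk : Tendsto x atTop (nhds k)) : g k = 0 := by
  have hmvt : ∀ n : ℕ, ∃ ξ : ℝ, (n : ℝ) ≤ ξ ∧ g (x ξ) = x (n + 1) - x n := by
    intro n
    obtain ⟨ξ, hξ, h⟩ := exists_hasDerivAt_eq_slope x (fun t => g (x t))
      (show (n : ℝ) < n + 1 by linarith)
      (fun s hs => (hx s (n.cast_nonneg.trans hs.1)).continuousAt.continuousWithinAt)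
      (fun s hs => hx s (n.cast_nonneg.trans hs.1.le))
    exact ⟨ξ, hξ.1.le, by simpa using h⟩
  choose ξ hξ hgξ using hmvt
  have hξ' : Tendsto ξ atTop atTop := tendsto_atTop_mono hξ tendsto_natCast_atTop_atTop
  have h1 : Tendsto (fun n => g (x (ξ n))) atTop (nhds (g k)) := hg.tendsto.comp (hk.comp hξ')
  have h2 : Tendsto (fun n : ℕ => x (n + 1) - x n) atTop (nhds (k - k)) :=
    (hk.comp (tendsto_atTop_add_const_right _ 1 tendsto_natCast_atTop_atTop)).sub
      (hk.comp tendsto_natCast_atTop_atTop)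
  rw [sub_self] at h2
  exact tendsto_nhds_unique (h1.congr hgξ) h2

/-- An exponentially decaying weight is dominated by a multiple of the exponential. -/
theorem exists_le_mul_exp {h : ℝ → ℝ} {ρ T : ℝ} (hρ : 0 < ρ)
    (hanti : AntitoneOn h (Ici 0)) (h0 : h 0 = 1) (hlim : Tendsto h atTop (nhds 0))
    (hdec : ∀ t ≥ T, h t ≤ Real.exp (-ρ * t)) :
    ∀ t, 0 ≤ t → |h t| ≤ Real.exp (ρ * |T|) * Real.exp (-ρ * t) := by
  intro t ht
  have hpos : 0 ≤ h t := le_of_tendsto hlim <| (eventually_ge_atTop t).mono fun s hs =>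
    hanti ht (ht.trans hs) hs
  rw [abs_of_nonneg hpos, ← Real.exp_add]
  rcases le_total T t with h1 | h1
  · refine (hdec t h1).trans (Real.exp_le_exp.2 ?_)
    have := mul_nonneg hρ.le (abs_nonneg T)
    linarith
  · calc h t ≤ h 0 := hanti (mem_Ici.2 le_rfl) ht ht
      _ = 1 := h0
      _ ≤ _ := Real.one_le_exp (by nlinarith [le_abs_self T])

/-- Differentiation under a discounted integral along a shift of time. -/
theorem tendsto_integral_shift {h y y' : ℝ → ℝ} {M ρ B C : ℝ} (hρ : 0 < ρ)
    (hh : ContinuousOn h (Ici 0)) (hM : ∀ t, 0 ≤ t → |h t| ≤ M * Real.exp (-ρ * t))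
    (hy : ∀ t, 0 ≤ t → HasDerivAt y (y' t) t) (hB : ∀ t, 0 ≤ t → |y t| ≤ B)
    (hC : ∀ t, 0 ≤ t → |y' t| ≤ C) :
    Tendsto (fun s => s⁻¹ * ((∫ t in Ioi (0:ℝ), h t * y (t + s)) - ∫ t in Ioi (0:ℝ), h t * y t))
      (nhdsWithin 0 (Ioi 0)) (nhds (∫ t in Ioi (0:ℝ), h t * y' t)) := by
  have hexp : IntegrableOn (fun t => Real.exp (-ρ * t)) (Ioi 0) :=
    integrableOn_exp_mul_Ioi (by linarith) 0
  have hyc : ContinuousOn y (Ici 0) := fun t ht => (hy t ht).continuousAt.continuousWithinAt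
  have hsc : ∀ s, 0 ≤ s → ContinuousOn (fun t => h t * y (t + s)) (Ioi 0) := fun s hs =>
    (hh.mono Ioi_subset_Ici_self).mul
      (hyc.comp (by fun_prop) fun t ht => add_nonneg (le_of_lt ht) hs)
  have hint : ∀ s, 0 ≤ s → IntegrableOn (fun t => h t * y (t + s)) (Ioi 0) := by
    intro s hs
    refine Integrable.mono' ((hexp.const_mul M).mul_const B)
      ((hsc s hs).aestronglyMeasurable measurableSet_Ioi) ?_
    refine (ae_restrict_iff' measurableSet_Ioi).2 (ae_of_all _ fun t ht => ?_)
    rw [Real.norm_eq_abs, abs_mul]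
    exact mul_le_mul (hM t (le_of_lt ht)) (hB _ (add_nonneg (le_of_lt ht) hs)) (abs_nonneg _)
      ((abs_nonneg _).trans (hM t (le_of_lt ht)))
  have hint0 := hint 0 le_rfl
  simp only [add_zero] at hint0
  have key : Tendsto (fun s => ∫ t in Ioi (0:ℝ), s⁻¹ * (h t * y (t + s) - h t * y t))
      (nhdsWithin 0 (Ioi 0)) (nhds (∫ t in Ioi (0:ℝ), h t * y' t)) := by
    refine tendsto_integral_filter_of_dominated_convergence
      (fun t => M * Real.exp (-ρ * t) * C) ?_ ?_ ((hexp.const_mul M).mul_const C) ?_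
    · filter_upwards [self_mem_nhdsWithin] with s hs
      exact (((hint s (le_of_lt hs)).sub hint0).const_mul _).aestronglyMeasurable
    · filter_upwards [self_mem_nhdsWithin] with s hs
      refine (ae_restrict_iff' measurableSet_Ioi).2 (ae_of_all _ fun t ht => ?_)
      have ht : 0 < t := ht
      have hs : 0 < s := hs
      have hlip : ‖y (t + s) - y t‖ ≤ C * ‖t + s - t‖ :=
        (convex_Ici (0:ℝ)).norm_image_sub_le_of_norm_hasDerivWithin_le
          (fun r hr => (hy r hr).hasDerivWithinAt) hC ht.le (add_nonneg ht.le hs.le)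
      rw [add_sub_cancel_left, Real.norm_eq_abs, Real.norm_eq_abs, abs_of_pos hs] at hlip
      have hq : s⁻¹ * |y (t + s) - y t| ≤ C := by
        rw [inv_mul_le_iff₀ hs]
        linarith
      rw [Real.norm_eq_abs, ← mul_sub, mul_left_comm, abs_mul, abs_mul,
        abs_of_pos (inv_pos.2 hs)]
      exact mul_le_mul (hM t ht.le) hq (by positivity) ((abs_nonneg _).trans (hM t ht.le))
    · refine (ae_restrict_iff' measurableSet_Ioi).2 (ae_of_all _ fun t ht => ?_)
      have := (hasDerivAt_iff_tendsto_slope_zero.1 (hy t (le_of_lt ht))).mono_left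
        (nhdsWithin_mono 0 (fun s (hs : 0 < s) => hs.ne'))
      refine (this.const_mul (h t)).congr fun s => ?_
      simp only [smul_eq_mul]
      ring
  refine key.congr' ?_
  filter_upwards [self_mem_nhdsWithin] with s hs
  rw [integral_const_mul, integral_sub (hint s (le_of_lt hs)) hint0]

theorem sub_le_deriv_mul_sub {w : ℝ → ℝ} (hd : DifferentiableOn ℝ w (Ioi 0))
    (h2 : ∀ c > 0, deriv (deriv w) c < 0) {a c : ℝ} (ha : 0 < a) (hc : 0 < c) :
    w c - w a ≤ deriv w a * (c - a) := by
  have hconc : ConcaveOn ℝ (Ioi 0) w :=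
    (strictConcaveOn_of_deriv2_neg (convex_Ioi 0) hd.continuousOn (by
      intro x hx
      rw [interior_Ioi] at hx
      exact h2 x hx)).concaveOn
  have hda := (hd.differentiableAt (Ioi_mem_nhds ha)).hasDerivAt
  rcases lt_trichotomy a c with h | h | h
  · have := hconc.slope_le_of_hasDerivAt ha hc h hda
    rw [slope_def_field, div_le_iff₀ (by linarith)] at this
    exact this
  · simp [h]
  · have := hconc.le_slope_of_hasDerivAt hc ha h hda
    rw [slope_def_field, le_div_iff₀ (by linarith)] at this
    linarith

theorem integrableOn_discount {h y : ℝ → ℝ} {M ρ C : ℝ} (hρ : 0 < ρ)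
    (hh : ContinuousOn h (Ici 0)) (hM : ∀ t, 0 ≤ t → |h t| ≤ M * Real.exp (-ρ * t))
    (hy : ContinuousOn y (Ici 0)) (hC : ∀ t, 0 ≤ t → |y t| ≤ C) :
    IntegrableOn (fun t => h t * y t) (Ioi 0) := by
  have hexp : IntegrableOn (fun t => Real.exp (-ρ * t)) (Ioi 0) :=
    integrableOn_exp_mul_Ioi (by linarith) 0
  refine Integrable.mono' ((hexp.const_mul M).mul_const C)
    (((hh.mul hy).mono Ioi_subset_Ici_self).aestronglyMeasurable measurableSet_Ioi) ?_
  refine (ae_restrict_iff' measurableSet_Ioi).2 (ae_of_all _ fun t ht => ?_)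
  rw [Real.norm_eq_abs, abs_mul]
  exact mul_le_mul (hM t (le_of_lt ht)) (hC _ (le_of_lt ht)) (abs_nonneg _)
    ((abs_nonneg _).trans (hM t (le_of_lt ht)))

/-- The velocity along a trajectory solves the linearized equation. -/
theorem velocity_eq_mul_exp {g x : ℝ → ℝ} {N : Set ℝ} (hN : IsOpen N)
    (hg : ContDiffOn ℝ 1 g N)
    (hx : ∀ t, 0 ≤ t → HasDerivAt x (g (x t)) t) (hxN : ∀ t, 0 ≤ t → x t ∈ N)
    {t : ℝ} (ht : 0 ≤ t) :
    g (x t) = g (x 0) * Real.exp (∫ r in (0:ℝ)..t, deriv g (x r)) := by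
  refine eq_mul_exp_integral (z := fun t => g (x t)) (a := fun t => deriv g (x t)) ?_ ?_ ht
  · exact (hg.continuousOn_deriv_of_isOpen hN le_rfl).comp
      (fun t ht => (hx t ht).continuousAt.continuousWithinAt) hxN
  · intro t ht
    exact (((hg.differentiableOn one_ne_zero).differentiableAt
      (hN.mem_nhds (hxN t ht))).hasDerivAt).comp t (hx t ht)

/-- The slope of `g` at the limit of a nonconstant convergent trajectory is nonpositive. -/
theorem deriv_nonpos_of_tendsto {g x : ℝ → ℝ} {N : Set ℝ} {k : ℝ} (hN : IsOpen N) (hk : k ∈ N)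
    (hg : ContDiffOn ℝ 1 g N)
    (hx : ∀ t, 0 ≤ t → HasDerivAt x (g (x t)) t) (hxN : ∀ t, 0 ≤ t → x t ∈ N)
    (hlim : Tendsto x atTop (nhds k)) (h0 : g (x 0) ≠ 0) : deriv g k ≤ 0 := by
  by_contra! hpos
  have hgk : ContinuousAt g k := hg.continuousOn.continuousAt (hN.mem_nhds hk)
  have hg'k : ContinuousAt (deriv g) k :=
    (hg.continuousOn_deriv_of_isOpen hN le_rfl).continuousAt (hN.mem_nhds hk)
  obtain ⟨T, hT⟩ := eventually_atTop.1 ((hg'k.tendsto.comp hlim).eventually_const_le hpos)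
  set S := max T 0
  have hS0 : 0 ≤ S := le_max_right _ _
  have hvS : 0 < |g (x S)| := by
    rw [velocity_eq_mul_exp hN hg hx hxN hS0]
    exact abs_pos.2 (mul_ne_zero h0 (Real.exp_ne_zero _))
  have hle : ∀ t, 0 ≤ t → |g (x S)| ≤ |g (x (t + S))| := by
    intro t ht
    have := velocity_eq_mul_exp (x := fun t => x (t + S)) hN hg
      (fun t ht => (hx (t + S) (add_nonneg ht hS0)).comp_add_const t S)
      (fun t ht => hxN (t + S) (add_nonneg ht hS0)) ht
    simp only [zero_add] at this
    rw [this, abs_mul, Real.abs_exp]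
    refine le_mul_of_one_le_right (abs_nonneg _) (Real.one_le_exp ?_)
    refine intervalIntegral.integral_nonneg ht fun r hr => ?_
    exact hT (r + S) ((le_max_left T 0).trans (le_add_of_nonneg_left hr.1))
  have hz : Tendsto (fun t => |g (x (t + S))|) atTop (nhds |g k|) :=
    (hgk.tendsto.comp (hlim.comp (tendsto_atTop_add_const_right _ S tendsto_id))).abs
  have := ge_of_tendsto hz ((eventually_ge_atTop 0).mono hle)
  rw [eq_zero_of_tendsto_of_ode hgk hx hlim, abs_zero] at this
  linarith

/-- The marginal value of a discounted integral along the flow of a convergent scalar equation. -/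
theorem deriv_value_eq_integral {g F G V h H : ℝ → ℝ} {K : ℝ → ℝ → ℝ} {N : Set ℝ}
    {kinf M ρ : ℝ} (hN : IsOpen N) (hkinf : kinf ∈ N) (hρ : 0 < ρ)
    (hg : ContDiffOn ℝ 1 g N) (hF : ContDiffOn ℝ 1 F N) (hG : ContDiffOn ℝ 1 G N)
    (hV : ContDiffOn ℝ 1 V N)
    (hh : ContinuousOn h (Ici 0)) (hhM : ∀ t, 0 ≤ t → |h t| ≤ M * Real.exp (-ρ * t))
    (hH : ContinuousOn H (Ici 0)) (hHM : ∀ t, 0 ≤ t → |H t| ≤ M * Real.exp (-ρ * t))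
    (hK0 : ∀ k ∈ N, K 0 k = k)
    (hK : ∀ k ∈ N, ∀ t, 0 ≤ t → HasDerivAt (fun s => K s k) (g (K t k)) t)
    (hKN : ∀ k ∈ N, ∀ t, 0 ≤ t → K t k ∈ N)
    (hKlim : ∀ k ∈ N, Tendsto (fun t => K t k) atTop (nhds kinf))
    (hVint : ∀ k ∈ N, V k =
      (∫ t in Ioi (0:ℝ), h t * F (K t k)) + ∫ t in Ioi (0:ℝ), H t * G (K t k))
    {k : ℝ} (hk : k ∈ N) :
    deriv V k = ∫ t in Ioi (0:ℝ), (h t * deriv F (K t k) + H t * deriv G (K t k)) *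
      Real.exp (∫ r in (0:ℝ)..t, deriv g (K r k)) := by
  have hKc : ∀ k ∈ N, ContinuousOn (fun t => K t k) (Ici 0) := fun k hk t ht =>
    (hK k hk t ht).continuousAt.continuousWithinAt
  have hbdd : ∀ {p : ℝ → ℝ}, ContinuousOn p N → ∀ k ∈ N,
      ContinuousOn (fun t => p (K t k)) (Ici 0) ∧ ∃ C, ∀ t, 0 ≤ t → |p (K t k)| ≤ C := by
    intro p hp k hk
    have hc : ContinuousOn (fun t => p (K t k)) (Ici 0) := hp.comp (hKc k hk) (hKN k hk)
    exact ⟨hc, exists_abs_le_of_continuousOn_of_tendsto hc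
      ((hp.continuousAt (hN.mem_nhds hkinf)).tendsto.comp (hKlim k hk))⟩
  have hderiv : ∀ {p : ℝ → ℝ}, ContDiffOn ℝ 1 p N → ∀ k ∈ N, HasDerivAt p (deriv p k) k :=
    fun hp k hk => ((hp.differentiableOn one_ne_zero).differentiableAt
      (hN.mem_nhds hk)).hasDerivAt
  have hderivc : ∀ {p : ℝ → ℝ}, ContDiffOn ℝ 1 p N → ContinuousOn (deriv p) N :=
    fun hp => hp.continuousOn_deriv_of_isOpen hN le_rfl
  have hshift : ∀ k ∈ N, ∀ s, 0 ≤ s → ∀ t, 0 ≤ t → K t (K s k) = K (t + s) k := by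
    intro k hk s hs t ht
    refine ode_unique_of_contDiffOn (x := fun t => K t (K s k)) (y := fun t => K (t + s) k)
      hN hg (hK _ (hKN k hk s hs)) (hKN _ (hKN k hk s hs)) ?_ ?_ ?_ ht
    · exact fun t ht => (hK k hk (t + s) (add_nonneg ht hs)).comp_add_const t s
    · exact fun t ht => hKN k hk _ (add_nonneg ht hs)
    · simp only [zero_add]
      exact hK0 _ (hKN k hk s hs)
  have hvel : ∀ k ∈ N, ∀ t, 0 ≤ t →
      g (K t k) = g k * Real.exp (∫ r in (0:ℝ)..t, deriv g (K r k)) := by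
    intro k hk t ht
    have := velocity_eq_mul_exp hN hg (hK k hk) (hKN k hk) ht
    rwa [hK0 k hk] at this
  have hintshift : ∀ {w p : ℝ → ℝ}, ∀ k ∈ N, ∀ s, 0 ≤ s →
      ∫ t in Ioi (0:ℝ), w t * p (K t (K s k)) = ∫ t in Ioi (0:ℝ), w t * p (K (t + s) k) := by
    intro w p k hk s hs
    refine setIntegral_congr_fun measurableSet_Ioi fun t ht => ?_
    simp only [hshift k hk s hs t (le_of_lt ht)]
  have hmoving : ∀ k ∈ N, g k ≠ 0 → deriv V k = ∫ t in Ioi (0:ℝ),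
      (h t * deriv F (K t k) + H t * deriv G (K t k)) *
        Real.exp (∫ r in (0:ℝ)..t, deriv g (K r k)) := by
    intro k hk hgk
    have hpart : ∀ {w p : ℝ → ℝ}, ContinuousOn w (Ici 0) →
        (∀ t, 0 ≤ t → |w t| ≤ M * Real.exp (-ρ * t)) → ContDiffOn ℝ 1 p N →
        IntegrableOn (fun t => w t * (deriv p (K t k) * g (K t k))) (Ioi 0) ∧
        Tendsto (fun s => s⁻¹ * ((∫ t in Ioi (0:ℝ), w t * p (K t (K s k))) -
          ∫ t in Ioi (0:ℝ), w t * p (K t k)))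
          (nhdsWithin 0 (Ioi 0))
          (nhds (∫ t in Ioi (0:ℝ), w t * (deriv p (K t k) * g (K t k)))) := by
      intro w p hw hwM hp
      obtain ⟨-, B, hB⟩ := hbdd hp.continuousOn k hk
      obtain ⟨hyc, C, hC⟩ := hbdd ((hderivc hp).mul hg.continuousOn) k hk
      refine ⟨integrableOn_discount hρ hw hwM hyc hC, ?_⟩
      refine (tendsto_integral_shift (y := fun t => p (K t k)) hρ hw hwM
        (fun t ht => (hderiv hp _ (hKN k hk t ht)).comp t (hK k hk t ht)) hB hC).congr' ?_
      filter_upwards [self_mem_nhdsWithin] with s hs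
      rw [hintshift k hk s (le_of_lt hs)]
    obtain ⟨hi1, ht1⟩ := hpart hh hhM hF
    obtain ⟨hi2, ht2⟩ := hpart hH hHM hG
    have hVd : HasDerivAt (fun s => V (K s k)) (deriv V k * g k) 0 := by
      have := (hderiv hV _ (hKN k hk 0 le_rfl)).comp 0 (hK k hk 0 le_rfl)
      rwa [hK0 k hk] at this
    have hVt := (hasDerivAt_iff_tendsto_slope_zero.1 hVd).mono_left
      (nhdsWithin_mono 0 (show Ioi (0:ℝ) ⊆ {0}ᶜ from fun s hs => ne_of_gt hs))
    have heq := tendsto_nhds_unique (hVt.congr' ?_) (ht1.add ht2)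
    · rw [← integral_add hi1 hi2] at heq
      refine mul_right_cancel₀ hgk (heq.trans ?_)
      rw [← integral_mul_const]
      refine setIntegral_congr_fun measurableSet_Ioi fun t ht => ?_
      simp only [hvel k hk t (le_of_lt ht)]
      ring
    · filter_upwards [self_mem_nhdsWithin] with s hs
      rw [zero_add, hK0 k hk, smul_eq_mul, hVint k hk, hVint _ (hKN k hk s (le_of_lt hs))]
      ring
  have hginf : g kinf = 0 := eq_zero_of_tendsto_of_ode
    (hg.continuousOn.continuousAt (hN.mem_nhds hkinf)) (hK kinf hkinf) (hKlim kinf hkinf)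
  have hrest : ∀ k ∈ N, g k = 0 → ∀ t, 0 ≤ t → K t k = k := by
    intro k hk hgk t ht
    refine ode_unique_of_contDiffOn (y := fun _ => k) hN hg (hK k hk) (hKN k hk) ?_
      (fun _ _ => hk) (hK0 k hk) ht
    intro t _
    rw [hgk]
    exact hasDerivAt_const t k
  have hne : ∀ k ∈ N, k ≠ kinf → g k ≠ 0 := by
    intro k hk hkne hgk
    exact hkne (tendsto_nhds_unique (tendsto_const_nhds.congr'
      ((eventually_ge_atTop 0).mono fun t ht => (hrest k hk hgk t ht).symm)) (hKlim k hk))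
  rcases ne_or_eq k kinf with hkk | rfl
  · exact hmoving k hk (hne k hk hkk)
  obtain ⟨j, hj, hjk⟩ : ∃ j, j ∈ N ∧ j ≠ k :=
    ((eventually_nhdsWithin_of_eventually_nhds (hN.mem_nhds hk)).and
      (self_mem_nhdsWithin (s := {k}ᶜ))).exists
  have hgj := hne j hj hjk
  have hslope : deriv g k ≤ 0 := deriv_nonpos_of_tendsto hN hk hg (hK j hj) (hKN j hj)
    (hKlim j hj) (by rwa [hK0 j hj])
  obtain ⟨hF'c, A, hA⟩ := hbdd (hderivc hF) j hj
  obtain ⟨hG'c, B, hB⟩ := hbdd (hderivc hG) j hj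
  obtain ⟨hg'c, C, hC⟩ := hbdd (hderivc hg) j hj
  have hshiftlim : ∀ {p : ℝ → ℝ}, ContinuousOn p N → ∀ t,
      Tendsto (fun s => p (K (t + s) j)) atTop (nhds (p k)) := fun hp t =>
    (hp.continuousAt (hN.mem_nhds hk)).tendsto.comp
      ((hKlim j hj).comp (tendsto_atTop_add_const_left _ t tendsto_id))
  have hshiftc : ∀ {p : ℝ → ℝ} {s}, 0 ≤ s → ContinuousOn (fun t => p (K t j)) (Ici 0) →
      ContinuousOn (fun t => p (K (t + s) j)) (Ici 0) := fun hs hp =>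
    hp.comp (f := fun t => t + _) (by fun_prop) fun t ht => add_nonneg ht hs
  have hii : ∀ {s t : ℝ}, 0 ≤ s → 0 ≤ t →
      IntervalIntegrable (fun r => deriv g (K (r + s) j)) volume 0 t := fun hs ht =>
    ((hshiftc hs hg'c).mono (by rw [uIcc_of_le ht]; exact Icc_subset_Ici_self)).intervalIntegrable
  have hVs : ∀ᶠ s in atTop, deriv V (K s j) = ∫ t in Ioi (0:ℝ),
      (h t * deriv F (K (t + s) j) + H t * deriv G (K (t + s) j)) *
        Real.exp (∫ r in (0:ℝ)..t, deriv g (K (r + s) j)) := by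
    filter_upwards [eventually_ge_atTop 0] with s hs
    rw [hmoving _ (hKN j hj s hs) (by
      rw [hvel j hj s hs]
      exact mul_ne_zero hgj (Real.exp_ne_zero _))]
    refine setIntegral_congr_fun measurableSet_Ioi fun t ht => ?_
    have ht : 0 ≤ t := le_of_lt ht
    have hI : ∫ r in (0:ℝ)..t, deriv g (K r (K s j)) =
        ∫ r in (0:ℝ)..t, deriv g (K (r + s) j) := by
      refine intervalIntegral.integral_congr fun r hr => ?_
      rw [uIcc_of_le ht] at hr
      simp only [hshift j hj s hs r hr.1]
    simp only [hshift j hj s hs t ht, hI]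
  have hVlim : Tendsto (fun s => deriv V (K s j)) atTop (nhds (deriv V k)) := by
    simpa using hshiftlim (hderivc hV) 0
  refine tendsto_nhds_unique (hVlim.congr' hVs) ?_
  have hexp : IntegrableOn (fun t => Real.exp (-(ρ / 2) * t)) (Ioi 0) :=
    integrableOn_exp_mul_Ioi (by linarith) 0
  refine tendsto_integral_filter_of_dominated_convergence
    (fun t => M * (A + B) * Real.exp (-(ρ / 2) * t)) ?_ ?_ (hexp.const_mul _) ?_
  · filter_upwards [eventually_ge_atTop 0] with s hs
    refine ContinuousOn.aestronglyMeasurable ?_ measurableSet_Ioi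
    refine ContinuousOn.mono ?_ Ioi_subset_Ici_self
    refine ((hh.mul (hshiftc hs hF'c)).add (hH.mul (hshiftc hs hG'c))).mul
      (Real.continuous_exp.comp_continuousOn ?_)
    intro t ht
    have ht' : (0:ℝ) ≤ t + 1 := add_nonneg ht zero_le_one
    have hc := intervalIntegral.continuousOn_primitive_interval'
      (hii (s := s) hs ht') left_mem_uIcc
    rw [uIcc_of_le ht'] at hc
    refine (hc t ⟨ht, by linarith⟩).mono_of_mem_nhdsWithin ?_
    rw [← Ici_inter_Iic]
    exact inter_mem self_mem_nhdsWithin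
      (mem_nhdsWithin_of_mem_nhds (Iic_mem_nhds (by linarith)))
  · have hev : ∀ᶠ s in atTop, deriv g (K s j) ≤ ρ / 2 := by
      have := hshiftlim (hderivc hg) 0
      simp only [zero_add] at this
      exact this.eventually_le_const (by linarith)
    obtain ⟨T, hT⟩ := eventually_atTop.1 hev
    filter_upwards [eventually_ge_atTop 0, eventually_ge_atTop T] with s hs hsT
    refine (ae_restrict_iff' measurableSet_Ioi).2 (ae_of_all _ fun t ht => ?_)
    have ht : 0 ≤ t := le_of_lt ht
    have hI : ∫ r in (0:ℝ)..t, deriv g (K (r + s) j) ≤ ρ / 2 * t := by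
      calc _ ≤ ∫ r in (0:ℝ)..t, ρ / 2 :=
            intervalIntegral.integral_mono_on ht (hii hs ht) intervalIntegrable_const
              fun r hr => hT _ (by linarith [hr.1])
        _ = ρ / 2 * t := by rw [intervalIntegral.integral_const, sub_zero, smul_eq_mul, mul_comm]
    have hMpos : 0 ≤ M * Real.exp (-ρ * t) := (abs_nonneg _).trans (hhM t ht)
    have hQ : |h t * deriv F (K (t + s) j) + H t * deriv G (K (t + s) j)| ≤
        M * Real.exp (-ρ * t) * (A + B) := by
      refine (abs_add_le _ _).trans ?_
      rw [abs_mul, abs_mul, mul_add]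
      exact add_le_add
        (mul_le_mul (hhM t ht) (hA _ (add_nonneg ht hs)) (abs_nonneg _) hMpos)
        (mul_le_mul (hHM t ht) (hB _ (add_nonneg ht hs)) (abs_nonneg _) hMpos)
    rw [Real.norm_eq_abs, abs_mul, Real.abs_exp]
    calc _ ≤ M * Real.exp (-ρ * t) * (A + B) * Real.exp (ρ / 2 * t) :=
          mul_le_mul hQ (Real.exp_le_exp.2 hI) (Real.exp_nonneg _) ((abs_nonneg _).trans hQ)
      _ = M * (A + B) * (Real.exp (-ρ * t) * Real.exp (ρ / 2 * t)) := by ring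
      _ = _ := by rw [← Real.exp_add]; ring_nf
  · refine (ae_restrict_iff' measurableSet_Ioi).2 (ae_of_all _ fun t ht => ?_)
    have ht : 0 ≤ t := le_of_lt ht
    rw [hrest k hk hginf t ht]
    refine (((hshiftlim (hderivc hF) t).const_mul _).add
      ((hshiftlim (hderivc hG) t).const_mul _)).mul
      ((Real.continuous_exp.tendsto _).comp ?_)
    refine intervalIntegral.tendsto_integral_filter_of_dominated_convergence (fun _ => C)
      ?_ ?_ intervalIntegrable_const ?_
    · filter_upwards [eventually_ge_atTop 0] with s hs
      exact (hii hs ht).def'.aestronglyMeasurable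
    · filter_upwards [eventually_ge_atTop 0] with s hs
      refine ae_of_all _ fun r hr => ?_
      rw [uIoc_of_le ht] at hr
      exact hC _ (add_nonneg hr.1.le hs)
    · refine ae_of_all _ fun r hr => ?_
      rw [uIoc_of_le ht] at hr
      rw [hrest k hk hginf r hr.1.le]
      exact hshiftlim (hderivc hg) r

/-- A smooth utility evaluated along a `C¹` strategy. -/
theorem contDiffOn_utility_comp {u : ℝ → ℝ → ℝ} {σ : ℝ → ℝ} {N : Set ℝ} (hNpos : N ⊆ Ioi 0)
    (hu : ContDiffOn ℝ (⊤ : ℕ∞) (fun p : ℝ × ℝ => u p.1 p.2) (Ioi 0 ×ˢ Ioi 0))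
    (hσ : ContDiffOn ℝ 1 σ N) (hσpos : ∀ k ∈ N, 0 < σ k) :
    ContDiffOn ℝ 1 (fun k => u (σ k) k) N :=
  (hu.of_le (by exact_mod_cast le_top)).comp (hσ.prodMk contDiffOn_id)
    fun k hk => ⟨hσpos k hk, hNpos hk⟩

theorem deriv_utility_comp {u : ℝ → ℝ → ℝ} {σ : ℝ → ℝ} {k : ℝ} (hk : 0 < k)
    (hu : ContDiffOn ℝ (⊤ : ℕ∞) (fun p : ℝ × ℝ => u p.1 p.2) (Ioi 0 ×ˢ Ioi 0))
    (hσ : DifferentiableAt ℝ σ k) (hσpos : 0 < σ k) :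
    deriv (fun k => u (σ k) k) k = pd1 u (σ k) k * deriv σ k + pd2 u (σ k) k := by
  have hd : HasFDerivAt (fun p : ℝ × ℝ => u p.1 p.2)
      (fderiv ℝ (fun p : ℝ × ℝ => u p.1 p.2) (σ k, k)) (σ k, k) :=
    ((hu.differentiableOn (by simp)).differentiableAt
      (prod_mem_nhds (Ioi_mem_nhds hσpos) (Ioi_mem_nhds hk))).hasFDerivAt
  have h1 : pd1 u (σ k) k = fderiv ℝ (fun p : ℝ × ℝ => u p.1 p.2) (σ k, k) (1, 0) :=
    (hd.comp_hasDerivAt (f := fun x => (x, k)) (σ k)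
      ((hasDerivAt_id _).prodMk (hasDerivAt_const _ _))).deriv
  have h2 : pd2 u (σ k) k = fderiv ℝ (fun p : ℝ × ℝ => u p.1 p.2) (σ k, k) (0, 1) :=
    (hd.comp_hasDerivAt (f := fun y => (σ k, y)) k
      ((hasDerivAt_const _ _).prodMk (hasDerivAt_id _))).deriv
  have h3 : deriv (fun k => u (σ k) k) k =
      fderiv ℝ (fun p : ℝ × ℝ => u p.1 p.2) (σ k, k) (deriv σ k, 1) :=
    (hd.comp_hasDerivAt (f := fun y => (σ y, y)) k
      (hσ.hasDerivAt.prodMk (hasDerivAt_id _))).deriv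
  have h4 : ((deriv σ k, 1) : ℝ × ℝ) = deriv σ k • ((1, 0) : ℝ × ℝ) + (0, 1) := by simp
  rw [h1, h2, h3, h4, map_add, map_smul, smul_eq_mul, mul_comm]

theorem differentiableOn_utility_left {u : ℝ → ℝ → ℝ} {k : ℝ} (hk : 0 < k)
    (hu : ContDiffOn ℝ (⊤ : ℕ∞) (fun p : ℝ × ℝ => u p.1 p.2) (Ioi 0 ×ˢ Ioi 0)) :
    DifferentiableOn ℝ (fun c => u c k) (Ioi 0) :=
  (hu.differentiableOn (by simp)).comp (f := fun c => (c, k))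
    (differentiableOn_id.prodMk (differentiableOn_const k)) fun _ hc => ⟨hc, hk⟩


/-- Sufficiency: the integral equation characterizes equilibrium
strategies. If `V` is `C²` on a neighborhood `N` of `kinf`, satisfies the integral
equation (IE) with `σ(k) := φ(V'(k),k)`, and `σ` is convergent, then `σ` is an
equilibrium strategy. -/
theorem stmt_5
    (f : ℝ → ℝ) (u U : ℝ → ℝ → ℝ) (h H : ℝ → ℝ)
    (hf_conc : ConcaveOn ℝ (Set.Ici 0) f)
    (hf_cont : ContinuousOn f (Set.Ici 0))
    (hf_smooth : ContDiffOn ℝ (⊤ : ℕ∞) f (Set.Ioi 0))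
    (hf_inada0 : Tendsto (deriv f) (nhdsWithin 0 (Set.Ioi 0)) atTop)
    (hf_inada1 : ∃ L ≤ (0:ℝ), Tendsto (deriv f) atTop (nhds L))
    (hu_smooth : ContDiffOn ℝ (⊤ : ℕ∞) (fun p : ℝ × ℝ => u p.1 p.2) (Set.Ioi 0 ×ˢ Set.Ioi 0))
    (hU_smooth : ContDiffOn ℝ (⊤ : ℕ∞) (fun p : ℝ × ℝ => U p.1 p.2) (Set.Ioi 0 ×ˢ Set.Ioi 0))
    (hu_mono : ∀ k > (0:ℝ), StrictMonoOn (fun c => u c k) (Set.Ioi 0))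
    (hU_mono : ∀ k > (0:ℝ), StrictMonoOn (fun c => U c k) (Set.Ioi 0))
    (hu11 : ∀ c > (0:ℝ), ∀ k > (0:ℝ), pd11 u c k < 0)
    (hU11 : ∀ c > (0:ℝ), ∀ k > (0:ℝ), pd11 U c k < 0)
    (hh_smooth : ContDiffOn ℝ (⊤ : ℕ∞) h (Set.Ici 0))
    (hH_smooth : ContDiffOn ℝ (⊤ : ℕ∞) H (Set.Ici 0))
    (hh_anti : AntitoneOn h (Set.Ici 0)) (hH_anti : AntitoneOn H (Set.Ici 0))
    (hh0 : h 0 = 1) (hH0 : H 0 = 1)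
    (hh_lim : Tendsto h atTop (nhds 0)) (hH_lim : Tendsto H atTop (nhds 0))
    (hdecay : ∃ ρ > (0:ℝ), ∃ T > (0:ℝ), ∀ t ≥ T,
      h t ≤ Real.exp (-ρ * t) ∧ H t ≤ Real.exp (-ρ * t))
    (φ : ℝ → ℝ → ℝ)
    (hφ : ∀ k > (0:ℝ), ∀ x > (0:ℝ),
      0 < φ x k ∧ pd1 u (φ x k) k + pd1 U (φ x k) k = x)
    (N : Set ℝ) (hNopen : IsOpen N) (hNpos : N ⊆ Set.Ioi 0)
    (kinf : ℝ) (hkinfN : kinf ∈ N)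
    -- V is twice continuously differentiable on N, with positive marginal value
    (V : ℝ → ℝ) (hVC2 : ContDiffOn ℝ 2 V N) (hVpos : ∀ k ∈ N, 0 < deriv V k)
    -- the strategy σ(k) = φ(V'(k),k), a C¹ Markov strategy
    (σ : ℝ → ℝ) (hσdef : ∀ k ∈ N, σ k = φ (deriv V k) k)
    (hσC1 : ContDiffOn ℝ 1 σ N)
    -- flow of σ, staying in N and converging to kinf, with linearized flow R
    (K R : ℝ → ℝ → ℝ)
    (hK0 : ∀ k₀ ∈ N, K 0 k₀ = k₀)
    (hKode : ∀ k₀ ∈ N, ∀ t : ℝ, 0 ≤ t →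
      HasDerivAt (fun s => K s k₀) (f (K t k₀) - σ (K t k₀)) t)
    (hKstay : ∀ k₀ ∈ N, ∀ t : ℝ, 0 ≤ t → K t k₀ ∈ N)
    (hKconv : ∀ k₀ ∈ N, Tendsto (fun t => K t k₀) atTop (nhds kinf))
    (hR0 : ∀ k₀ ∈ N, R k₀ 0 = 1)
    (hRode : ∀ k₀ ∈ N, ∀ t : ℝ, 0 ≤ t →
      HasDerivAt (R k₀) ((deriv f (K t k₀) - deriv σ (K t k₀)) * R k₀ t) t)
    -- the integral equation (IE)
    (hIE : ∀ k₀ ∈ N, V k₀ =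
      (∫ t in Set.Ioi (0:ℝ),
        h t * u (φ (deriv V (K t k₀)) (K t k₀)) (K t k₀)) +
      ∫ t in Set.Ioi (0:ℝ),
        H t * U (φ (deriv V (K t k₀)) (K t k₀)) (K t k₀)) :
    -- conclusion: σ is an equilibrium strategy
    ∀ k ∈ N, ∀ c > (0:ℝ),
      Pval u U h H σ K R k c ≤ Pval u U h H σ K R k (σ k) := by
  obtain ⟨ρ, hρ, T, -, hdec⟩ := hdecay
  have hσpos : ∀ k ∈ N, 0 < σ k := fun k hk => by
    rw [hσdef k hk]
    exact (hφ k (hNpos hk) _ (hVpos k hk)).1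
  have hσd : ∀ k ∈ N, DifferentiableAt ℝ σ k := fun k hk =>
    (hσC1.differentiableOn one_ne_zero).differentiableAt (hNopen.mem_nhds hk)
  have hgC1 : ContDiffOn ℝ 1 (fun k => f k - σ k) N :=
    ((hf_smooth.of_le (by exact_mod_cast le_top)).mono hNpos).sub hσC1
  have hg' : ∀ k ∈ N, deriv (fun k => f k - σ k) k = deriv f k - deriv σ k := fun k hk =>
    deriv_fun_sub ((hf_smooth.differentiableOn (by simp)).differentiableAt
      (Ioi_mem_nhds (hNpos hk))) (hσd k hk)
  have hR : ∀ k ∈ N, ∀ t, 0 ≤ t →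
      R k t = Real.exp (∫ r in (0:ℝ)..t, deriv (fun k => f k - σ k) (K r k)) := by
    intro k hk t ht
    have hc : ContinuousOn (fun t => deriv (fun k => f k - σ k) (K t k)) (Ici 0) :=
      (hgC1.continuousOn_deriv_of_isOpen hNopen le_rfl).comp
        (fun t ht => (hKode k hk t ht).continuousAt.continuousWithinAt) (hKstay k hk)
    rw [eq_mul_exp_integral (z := R k) hc (fun t ht => by
      rw [hg' _ (hKstay k hk t ht)]
      exact hRode k hk t ht) ht, hR0 k hk, one_mul]
  intro k hk c hc
  have hkpos : 0 < k := hNpos hk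
  have hmarginal : deriv V k = ∫ t in Ioi (0:ℝ),
      (h t * (pd1 u (σ (K t k)) (K t k) * deriv σ (K t k) + pd2 u (σ (K t k)) (K t k)) +
       H t * (pd1 U (σ (K t k)) (K t k) * deriv σ (K t k) + pd2 U (σ (K t k)) (K t k)))
      * R k t := by
    rw [deriv_value_eq_integral (g := fun k => f k - σ k) (F := fun k => u (σ k) k)
      (G := fun k => U (σ k) k) hNopen hkinfN hρ hgC1
      (contDiffOn_utility_comp hNpos hu_smooth hσC1 hσpos)
      (contDiffOn_utility_comp hNpos hU_smooth hσC1 hσpos)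
      (hVC2.of_le one_le_two)
      hh_smooth.continuousOn
      (exists_le_mul_exp hρ hh_anti hh0 hh_lim fun t ht => (hdec t ht).1)
      hH_smooth.continuousOn
      (exists_le_mul_exp hρ hH_anti hH0 hH_lim fun t ht => (hdec t ht).2)
      hK0 hKode hKstay hKconv ?_ hk]
    · refine setIntegral_congr_fun measurableSet_Ioi fun t ht => ?_
      have ht : 0 ≤ t := le_of_lt ht
      have hKt := hKstay k hk t ht
      rw [deriv_utility_comp (hNpos hKt) hu_smooth (hσd _ hKt) (hσpos _ hKt),
        deriv_utility_comp (hNpos hKt) hU_smooth (hσd _ hKt) (hσpos _ hKt), hR k hk t ht]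
    · intro j hj
      rw [hIE j hj]
      congr 1 <;>
      · refine setIntegral_congr_fun measurableSet_Ioi fun t ht => ?_
        simp only [hσdef _ (hKstay j hj t (le_of_lt ht))]
  have hfoc : pd1 u (σ k) k + pd1 U (σ k) k = deriv V k := by
    rw [hσdef k hk]
    exact (hφ k hkpos _ (hVpos k hk)).2
  have hu_le : u c k - u (σ k) k ≤ pd1 u (σ k) k * (c - σ k) :=
    sub_le_deriv_mul_sub (w := fun c => u c k) (differentiableOn_utility_left hkpos hu_smooth)
      (fun c hc => hu11 c hc k hkpos) (hσpos k hk) hc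
  have hU_le : U c k - U (σ k) k ≤ pd1 U (σ k) k * (c - σ k) :=
    sub_le_deriv_mul_sub (w := fun c => U c k) (differentiableOn_utility_left hkpos hU_smooth)
      (fun c hc => hU11 c hc k hkpos) (hσpos k hk) hc
  simp only [Pval, ← mul_assoc, integral_mul_const, ← hmarginal]
  rw [← hfoc]
  linarith
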